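/- Let (X,Y) be a bivariate random vector such that Y is not almost surely a constant. Then the Dette–Siburg–Stoimenov dependence measure satisfies ξ(X,Y) = 1 if and only if Y is equal to a measurable function of X almost surely. -/

import Mathlib

open MeasureTheory ProbabilityTheory Filter

noncomputable section

/-- The Dette–Siburg–Stoimenov dependence measure
`ξ(X,Y) = ∫ Var(E[1{Y ≥ y} | X]) dF_Y(y) / ∫ Var(1{Y ≥ y}) dF_Y(y)`. -/
def dss {Ω : Type*} [MeasurableSpace Ω] (P : Measure Ω) (X Y : Ω → ℝ) : ℝ :=
  (∫ y, variance (P[(fun ω => if y ≤ Y ω then (1 : ℝ) else 0) |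
      MeasurableSpace.comap X inferInstance]) P ∂(P.map Y)) /
  (∫ y, variance (fun ω => if y ≤ Y ω then (1 : ℝ) else 0) P ∂(P.map Y))

/-- Every set of reals has a countable coinitial subset. -/
lemma exists_countable_coinitial (S : Set ℝ) :
    ∃ C ⊆ S, C.Countable ∧ ∀ s ∈ S, ∃ c ∈ C, c ≤ s := by
  by_cases hmin : ∃ m ∈ S, ∀ s ∈ S, m ≤ s
  · obtain ⟨m, hm, hle⟩ := hmin
    exact ⟨{m}, by simpa using hm, Set.countable_singleton m, fun s hs => ⟨m, rfl, hle s hs⟩⟩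
  · push Not at hmin
    obtain ⟨C, hCS, hC, hU⟩ := TopologicalSpace.isOpen_biUnion_countable S Set.Ioi
      (fun _ _ => isOpen_Ioi)
    refine ⟨C, hCS, hC, fun s hs => ?_⟩
    obtain ⟨t, ht, hts⟩ := hmin s hs
    have : s ∈ ⋃ i ∈ C, Set.Ioi i := hU ▸ Set.mem_biUnion ht hts
    simp only [Set.mem_iUnion, Set.mem_Ioi, exists_prop] at this
    obtain ⟨c, hc, hcs⟩ := this
    exact ⟨c, hc, hcs.le⟩

/-- If almost every superlevel event of `Y` is determined by `X`, then all of them are. -/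
lemma exists_preimage_ae_iff_of_ae {Ω : Type*} [MeasurableSpace Ω] {P : Measure Ω}
    {X Y : Ω → ℝ} (hY : Measurable Y)
    (h : ∀ᵐ y ∂(P.map Y), ∃ A : Set ℝ, MeasurableSet A ∧ ∀ᵐ ω ∂P, y ≤ Y ω ↔ X ω ∈ A) (q : ℝ) :
    ∃ A : Set ℝ, MeasurableSet A ∧ ∀ᵐ ω ∂P, q ≤ Y ω ↔ X ω ∈ A := by
  obtain ⟨C, hCS, hC, hle⟩ := exists_countable_coinitial
    {y | q ≤ y ∧ ∃ A : Set ℝ, MeasurableSet A ∧ ∀ᵐ ω ∂P, y ≤ Y ω ↔ X ω ∈ A}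
  choose! A hA hAe using fun c (hc : c ∈ C) => (hCS hc).2
  refine ⟨⋃ c ∈ C, A c, .biUnion hC hA, ?_⟩
  filter_upwards [ae_of_ae_map hY.aemeasurable h, (ae_ball_iff hC).2 hAe] with ω hω hCω
  simp only [Set.mem_iUnion, exists_prop]
  constructor
  · intro hq
    obtain ⟨c, hc, hcY⟩ := hle (Y ω) ⟨hq, hω⟩
    exact ⟨c, hc, (hCω c hc).1 hcY⟩
  · rintro ⟨c, hc, hcX⟩
    exact (hCS hc).1.trans ((hCω c hc).2 hcX)

/-- If almost every superlevel event of `Y` is determined by `X`, then `Y` is almost surely a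
measurable function of `X`. -/
lemma exists_measurable_ae_eq_of_ae {Ω : Type*} [MeasurableSpace Ω] {P : Measure Ω}
    {X Y : Ω → ℝ} (hY : Measurable Y)
    (h : ∀ᵐ y ∂(P.map Y), ∃ A : Set ℝ, MeasurableSet A ∧ ∀ᵐ ω ∂P, y ≤ Y ω ↔ X ω ∈ A) :
    ∃ f : ℝ → ℝ, Measurable f ∧ ∀ᵐ ω ∂P, Y ω = f (X ω) := by
  classical
  choose A hA hAe using fun q : ℚ => exists_preimage_ae_iff_of_ae hY h q
  refine ⟨fun x => (⨆ q : ℚ, if x ∈ A q then (((q : ℝ)) : EReal) else ⊥).toReal,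
    (Measurable.iSup fun q =>
      Measurable.ite (hA q) measurable_const measurable_const).ereal_toReal, ?_⟩
  filter_upwards [ae_all_iff.2 hAe] with ω hω
  have : (⨆ q : ℚ, if X ω ∈ A q then (((q : ℝ)) : EReal) else ⊥) = (Y ω : EReal) := by
    refine le_antisymm (iSup_le fun q => ?_) (le_of_forall_lt fun z hz => ?_)
    · split_ifs with hq
      · exact_mod_cast (hω q).2 hq
      · exact bot_le
    · obtain ⟨q, hzq, hqY⟩ := EReal.lt_iff_exists_rat_btwn.1 hz
      refine hzq.trans_le (le_iSup_of_le q ?_)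
      rw [if_pos ((hω q).1 (by exact_mod_cast hqY.le))]
  rw [this, EReal.toReal_coe]

section Variance

variable {Ω : Type*} {m : MeasurableSpace Ω} [mΩ : MeasurableSpace Ω] {P : Measure Ω}
  [IsProbabilityMeasure P] {Y : Ω → ℝ}

lemma memLp_ite_le (hY : Measurable Y) (p : ENNReal) (y : ℝ) :
    MemLp (fun ω => if y ≤ Y ω then (1 : ℝ) else 0) p P :=
  MemLp.of_bound (Measurable.ite (measurableSet_le measurable_const hY) measurable_const
    measurable_const).aestronglyMeasurable 1 (ae_of_all _ fun ω => by split_ifs <;> simp)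

/-- The law of total variance, with the residual term written as a mean square. -/
lemma variance_sub_variance_condExp (hm : m ≤ mΩ) {Z : Ω → ℝ} (hZ : MemLp Z 2 P) :
    variance Z P - variance (P[Z | m]) P = ∫ ω, (Z ω - P[Z | m] ω) ^ 2 ∂P := by
  have h := integral_condVar_add_variance_condExp hm hZ
  have h2 : ∫ ω, condVar m Z P ω ∂P = ∫ ω, (Z ω - P[Z | m] ω) ^ 2 ∂P := integral_condExp hm
  linarith

lemma variance_condExp_le (hm : m ≤ mΩ) {Z : Ω → ℝ} (hZ : MemLp Z 2 P) :
    variance (P[Z | m]) P ≤ variance Z P := by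
  have := variance_sub_variance_condExp hm hZ
  have : 0 ≤ ∫ ω, (Z ω - P[Z | m] ω) ^ 2 ∂P := integral_nonneg fun ω => sq_nonneg _
  linarith

lemma ae_eq_condExp_of_variance_eq (hm : m ≤ mΩ) {Z : Ω → ℝ} (hZ : MemLp Z 2 P)
    (h : variance (P[Z | m]) P = variance Z P) : Z =ᵐ[P] P[Z | m] := by
  have h0 := variance_sub_variance_condExp hm hZ
  have hint : Integrable (fun ω => (Z ω - P[Z | m] ω) ^ 2) P :=
    (hZ.sub (hZ.condExp one_le_two)).integrable_sq
  rw [h, sub_self, eq_comm, integral_eq_zero_iff_of_nonneg (fun ω => sq_nonneg _) hint] at h0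
  filter_upwards [h0] with ω hω
  simpa [sub_eq_zero] using hω

lemma measurable_variance_condExp_ite_le (hm : m ≤ mΩ) (hY : Measurable Y) :
    Measurable fun y : ℝ => variance (P[(fun ω => if y ≤ Y ω then (1 : ℝ) else 0) | m]) P := by
  set Z : ℝ → Ω → ℝ := fun y ω => if y ≤ Y ω then (1 : ℝ) else 0
  have hZ (y : ℝ) : MemLp (Z y) 2 P := memLp_ite_le hY 2 y
  have hi (y : ℝ) : Integrable (Z y) P := (hZ y).integrable one_le_two
  have hanti {y z : ℝ} (hyz : y ≤ z) (ω : Ω) : Z z ω ≤ Z y ω := by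
    simp only [Z]
    split_ifs with h1 h2 <;> linarith
  have hmean : Antitone fun y => ∫ ω, Z y ω ∂P := fun y z hyz =>
    integral_mono (hi z) (hi y) (hanti hyz)
  have hsq : Antitone fun y => ∫ ω, (P[Z y | m] ω) ^ 2 ∂P := by
    intro y z hyz
    refine integral_mono_ae ((hZ z).condExp one_le_two).integrable_sq ((hZ y).condExp one_le_two).integrable_sq ?_
    filter_upwards [condExp_mono (m := m) (hi z) (hi y) (ae_of_all _ (hanti hyz)),
      condExp_nonneg (m := m) (μ := P) (f := Z z)
        (ae_of_all _ fun ω => by simp only [Z]; split_ifs <;> simp)] with ω h1 h2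
    exact pow_le_pow_left₀ h2 h1 2
  have heq (y : ℝ) : variance (P[Z y | m]) P =
      (∫ ω, (P[Z y | m] ω) ^ 2 ∂P) - (∫ ω, Z y ω ∂P) ^ 2 := by
    rw [variance_eq_sub ((hZ y).condExp one_le_two), integral_condExp hm]
    rfl
  rw [funext heq]
  exact hsq.measurable.sub (hmean.measurable.pow_const 2)

lemma variance_ite_le_le_one (hY : Measurable Y) (y : ℝ) :
    variance (fun ω => if y ≤ Y ω then (1 : ℝ) else 0) P ≤ 1 := by
  refine (variance_le_expectation_sq (memLp_ite_le hY 2 y).aestronglyMeasurable).trans ?_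
  calc _ ≤ ∫ _, (1 : ℝ) ∂P := integral_mono (memLp_ite_le hY 2 y).integrable_sq
        (integrable_const _) fun ω => by
          simp only
          split_ifs <;> simp
    _ = 1 := by simp

lemma integrable_variance_condExp_ite_le (hm : m ≤ mΩ) (hY : Measurable Y) :
    Integrable (fun y : ℝ => variance (P[(fun ω => if y ≤ Y ω then (1 : ℝ) else 0) | m]) P)
      (P.map Y) := by
  have := Measure.isProbabilityMeasure_map (μ := P) hY.aemeasurable
  refine .of_bound (measurable_variance_condExp_ite_le hm hY).aestronglyMeasurable 1
    (ae_of_all _ fun y => ?_)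
  rw [Real.norm_of_nonneg (variance_nonneg _ _)]
  exact (variance_condExp_le hm (memLp_ite_le hY 2 y)).trans (variance_ite_le_le_one hY y)

lemma integrable_variance_ite_le (hY : Measurable Y) :
    Integrable (fun y : ℝ => variance (fun ω => if y ≤ Y ω then (1 : ℝ) else 0) P)
      (P.map Y) := by
  refine (integrable_variance_condExp_ite_le (P := P) le_rfl hY).congr (ae_of_all _ fun y => ?_)
  have hm : Measurable fun ω => if y ≤ Y ω then (1 : ℝ) else 0 :=
    Measurable.ite (measurableSet_le measurable_const hY) measurable_const measurable_const
  simp only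
  rw [condExp_of_stronglyMeasurable le_rfl hm.stronglyMeasurable
    ((memLp_ite_le hY 1 y).integrable le_rfl)]

lemma integral_variance_ite_le_ne_zero (hY : Measurable Y)
    (hconst : ¬ ∃ c : ℝ, ∀ᵐ ω ∂P, Y ω = c) :
    ∫ y, variance (fun ω => if y ≤ Y ω then (1 : ℝ) else 0) P ∂(P.map Y) ≠ 0 := by
  intro h0
  rw [integral_eq_zero_iff_of_nonneg (fun y => variance_nonneg _ _)
    (integrable_variance_ite_le hY)] at h0
  obtain ⟨f, -, hf⟩ := exists_measurable_ae_eq_of_ae (P := P) (X := fun _ => 0) hY <| by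
    filter_upwards [h0] with y hy
    have hZ := memLp_ite_le (P := P) hY 2 y
    have hc := ae_eq_condExp_of_variance_eq (P := P) (m := ⊥) bot_le hZ
      (le_antisymm (variance_condExp_le bot_le hZ)
        (hy.trans_le (variance_nonneg _ _)))
    rw [condExp_bot] at hc
    refine ⟨{_x | (1 : ℝ) ≤ ∫ ω, (if y ≤ Y ω then (1 : ℝ) else 0) ∂P}, .const _, ?_⟩
    filter_upwards [hc] with ω hω
    rw [← hω]
    split_ifs with h <;> simp [h]
  exact hconst ⟨f 0, hf⟩

end Variance

/-- If `Y` is not almost surely a constant, then `ξ(X,Y) = 1` if and only if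
`Y` is equal to a measurable function of `X` almost surely. -/
theorem dss_eq_one_iff_measurable_function
    {Ω : Type*} [MeasurableSpace Ω] (P : Measure Ω) [IsProbabilityMeasure P]
    (X Y : Ω → ℝ) (hX : Measurable X) (hY : Measurable Y)
    (hconst : ¬ ∃ c : ℝ, ∀ᵐ ω ∂P, Y ω = c) :
    dss P X Y = 1 ↔ ∃ f : ℝ → ℝ, Measurable f ∧ ∀ᵐ ω ∂P, Y ω = f (X ω) := by
  have hm := hX.comap_le
  rw [dss, div_eq_one_iff_eq (integral_variance_ite_le_ne_zero hY hconst)]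
  constructor
  · intro h
    rw [integral_eq_iff_of_ae_le (integrable_variance_condExp_ite_le hm hY)
      (integrable_variance_ite_le hY)
      (ae_of_all _ fun y => variance_condExp_le hm (memLp_ite_le hY 2 y))] at h
    refine exists_measurable_ae_eq_of_ae hY ?_
    filter_upwards [h] with y hy
    have hc := ae_eq_condExp_of_variance_eq hm (memLp_ite_le hY 2 y) hy
    obtain ⟨A, hA, hAX⟩ := measurableSet_le (measurable_const (a := (1 : ℝ)))
      (stronglyMeasurable_condExp (μ := P) (m := MeasurableSpace.comap X inferInstance)
        (f := fun ω => if y ≤ Y ω then (1 : ℝ) else 0)).measurable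
    refine ⟨A, hA, ?_⟩
    filter_upwards [hc] with ω hω
    rw [← Set.mem_preimage, hAX, Set.mem_ofPred_eq, ← hω]
    split_ifs with h <;> simp [h]
  · rintro ⟨f, hf, hfY⟩
    refine integral_congr_ae (ae_of_all _ fun y => variance_congr ?_)
    have hZ : (fun ω => if y ≤ Y ω then (1 : ℝ) else 0) =ᵐ[P]
        fun ω => if y ≤ f (X ω) then (1 : ℝ) else 0 := by
      filter_upwards [hfY] with ω hω
      rw [hω]
    have hg : Measurable[MeasurableSpace.comap X inferInstance]
        fun ω => if y ≤ f (X ω) then (1 : ℝ) else 0 :=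
      (Measurable.ite (measurableSet_le measurable_const hf) measurable_const
        measurable_const : Measurable fun x => if y ≤ f x then (1 : ℝ) else 0).comp
        (comap_measurable X)
    refine (condExp_congr_ae hZ).trans ?_
    rw [condExp_of_stronglyMeasurable hm hg.stronglyMeasurable
      ((memLp_ite_le (hf.comp hX) 1 y).integrable le_rfl)]
    exact hZ.symm
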